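/- arXiv:1511.06866 — 6 statements merged into one kernel-verified Lean document; each statement's English description precedes it below -/
import Mathlib

section
/- Let F ∈ ℝ^{m×m} be stable (all complex eigenvalues of F have modulus strictly less than 1) and let Q ∈ ℝ^{m×m} be symmetric positive semidefinite. Then the discrete Lyapunov equation Σ = FΣFᵀ + Q has a unique symmetric positive semidefinite solution Σ, and if moreover the pair (F, Q) is controllable, then this solution Σ is invertible (equivalently, Σ is positive definite). -/
open Matrix

/-- A real square matrix is (Schur) stable if all of its complex eigenvalues
have modulus strictly less than `1`. -/
def IsStableMatrix {m : ℕ} (F : Matrix (Fin m) (Fin m) ℝ) : Prop :=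
  ∀ (μ : ℂ) (x : Fin m → ℂ), x ≠ 0 →
    (F.map (Complex.ofReal)).mulVec x = μ • x → ‖μ‖ < 1

/-- The pair `(A, B)` is controllable: there is no nonzero (left) vector `x ∈ ℂ^m`
and scalar `μ ∈ ℂ` with `xᵀ A = μ xᵀ` and `xᵀ B = 0`; equivalently `(A - λI  B)`
has full row rank for every `λ ∈ ℂ`. -/
def Controllable {m r : ℕ} (A : Matrix (Fin m) (Fin m) ℝ)
    (B : Matrix (Fin m) (Fin r) ℝ) : Prop :=
  ∀ (μ : ℂ) (x : Fin m → ℂ), x ≠ 0 →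
    Matrix.vecMul x (A.map (Complex.ofReal)) = μ • x →
    Matrix.vecMul x (B.map (Complex.ofReal)) = 0 → False

open Filter Topology

section PowerConvergence

attribute [local instance] Matrix.linftyOpNormedRing Matrix.linftyOpNormedAlgebra

/-- In a complex Banach algebra, the powers of an element of spectral radius less than one
tend to zero. -/
theorem tendsto_pow_nhds_zero_of_spectralRadius_lt_one {A : Type*} [NormedRing A]
    [NormedAlgebra ℂ A] [CompleteSpace A] {a : A} (ha : spectralRadius ℂ a < 1) :
    Tendsto (fun n : ℕ => a ^ n) atTop (𝓝 0) := by
  obtain ⟨r, har, hr⟩ := ENNReal.lt_iff_exists_nnreal_btwn.1 ha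
  have hr1 : r < 1 := by exact_mod_cast hr
  have hlim := (spectrum.pow_nnnorm_pow_one_div_tendsto_nhds_spectralRadius a).eventually_lt_const
    har
  refine squeeze_zero_norm' (a := fun n : ℕ => (r : ℝ) ^ n) ?_
    (tendsto_pow_atTop_nhds_zero_of_lt_one r.2 (by exact_mod_cast hr1))
  filter_upwards [hlim, eventually_gt_atTop 0] with n hn hn0
  have hn' : (n : ℝ) ≠ 0 := by positivity
  have h := ENNReal.rpow_le_rpow hn.le (Nat.cast_nonneg (α := ℝ) n)
  rw [← ENNReal.rpow_mul, one_div_mul_cancel hn', ENNReal.rpow_one, ENNReal.rpow_natCast] at h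
  exact_mod_cast h

theorem IsStableMatrix.tendsto_pow {m : ℕ} {F : Matrix (Fin m) (Fin m) ℝ}
    (hF : IsStableMatrix F) : Tendsto (fun n : ℕ => F ^ n) atTop (𝓝 0) := by
  rcases isEmpty_or_nonempty (Fin m) with hm | hm
  · exact tendsto_const_nhds.congr fun n => Subsingleton.elim _ _
  let G : Matrix (Fin m) (Fin m) ℂ := F.map Complex.ofReal
  have hρ : spectralRadius ℂ G < 1 := by
    refine spectrum.spectralRadius_lt_of_forall_lt G fun z hz => ?_
    rw [← Matrix.spectrum_toLin', ← Module.End.hasEigenvalue_iff_mem_spectrum] at hz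
    obtain ⟨x, hx⟩ := hz.exists_hasEigenvector
    have := hF z x hx.2 (by simpa using hx.apply_eq_smul)
    exact_mod_cast this
  have hpow := tendsto_pow_nhds_zero_of_spectralRadius_lt_one hρ
  refine tendsto_pi_nhds.2 fun i => tendsto_pi_nhds.2 fun j => ?_
  have hij := (Complex.continuous_re.tendsto _).comp
    (((continuous_apply_apply (ρ := fun _ _ => ℂ) i j).tendsto _).comp hpow)
  refine (hij.congr fun n => ?_)
  have : G ^ n = (F ^ n).map Complex.ofReal :=
    (map_pow Complex.ofRealHom.mapMatrix F n).symm
  change ((G ^ n) i j).re = (F ^ n) i j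
  simp [this]

end PowerConvergence

section Lyapunov

variable {n : Type*} [Fintype n]

theorem isClosed_setOf_posSemidef : IsClosed {S : Matrix n n ℝ | S.PosSemidef} := by
  simp only [posSemidef_iff_dotProduct_mulVec, Set.ofPred_and, Set.ofPred_forall, IsHermitian]
  refine (isClosed_eq (by fun_prop) continuous_id).inter (isClosed_iInter fun x => ?_)
  exact isClosed_le continuous_const (by fun_prop)

variable [DecidableEq n] {F Q S : Matrix n n ℝ}

theorem tendsto_pow_mul_mul_transpose_pow (hF : Tendsto (fun k : ℕ => F ^ k) atTop (𝓝 0))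
    (S : Matrix n n ℝ) : Tendsto (fun k : ℕ => F ^ k * S * (F ^ k)ᵀ) atTop (𝓝 0) := by
  have hc : Continuous fun A : Matrix n n ℝ => A * S * Aᵀ := by fun_prop
  simpa [Function.comp_def] using (hc.tendsto 0).comp hF

/-- The homogeneous discrete Lyapunov equation has only the zero solution. -/
theorem eq_zero_of_eq_mul_mul_transpose (hF : Tendsto (fun k : ℕ => F ^ k) atTop (𝓝 0))
    (hS : S = F * S * Fᵀ) : S = 0 := by
  have h : ∀ k : ℕ, F ^ k * S * (F ^ k)ᵀ = S := by
    intro k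
    induction k with
    | zero => simp
    | succ k ih =>
      calc F ^ (k + 1) * S * (F ^ (k + 1))ᵀ = F ^ k * (F * S * Fᵀ) * (F ^ k)ᵀ := by
            simp only [pow_succ, transpose_mul, Matrix.mul_assoc]
        _ = S := by rw [← hS, ih]
  exact tendsto_nhds_unique (tendsto_const_nhds.congr fun k => (h k).symm)
    (tendsto_pow_mul_mul_transpose_pow hF S)

theorem exists_eq_mul_mul_transpose_add (hF : Tendsto (fun k : ℕ => F ^ k) atTop (𝓝 0))
    (Q : Matrix n n ℝ) : ∃ S, S = F * S * Fᵀ + Q := by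
  let L : Matrix n n ℝ →ₗ[ℝ] Matrix n n ℝ :=
    LinearMap.id - LinearMap.mulRight ℝ Fᵀ ∘ₗ LinearMap.mulLeft ℝ F
  have hL : Function.Injective L := by
    rw [← LinearMap.ker_eq_bot, LinearMap.ker_eq_bot']
    intro S hS
    exact eq_zero_of_eq_mul_mul_transpose hF (sub_eq_zero.1 hS)
  obtain ⟨S, hS⟩ := LinearMap.injective_iff_surjective.1 hL Q
  exact ⟨S, sub_eq_iff_eq_add'.1 hS⟩

theorem posSemidef_of_eq_mul_mul_transpose_add (hF : Tendsto (fun k : ℕ => F ^ k) atTop (𝓝 0))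
    (hQ : Q.PosSemidef) (hS : S = F * S * Fᵀ + Q) : S.PosSemidef := by
  have h : ∀ k : ℕ, (S - F ^ k * S * (F ^ k)ᵀ).PosSemidef := by
    intro k
    induction k with
    | zero => simpa using PosSemidef.zero
    | succ k ih =>
      have hk : S - F ^ (k + 1) * S * (F ^ (k + 1))ᵀ
          = F * (S - F ^ k * S * (F ^ k)ᵀ) * Fᵀ + Q := by
        calc S - F ^ (k + 1) * S * (F ^ (k + 1))ᵀ
            = (F * S * Fᵀ + Q) - F ^ (k + 1) * S * (F ^ (k + 1))ᵀ := by rw [← hS]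
          _ = _ := by
            simp only [pow_succ', transpose_mul, Matrix.mul_assoc, Matrix.mul_sub, Matrix.sub_mul]
            abel
      rw [hk]
      exact (ih.mul_mul_conjTranspose_same F).add hQ
  have hlim : Tendsto (fun k : ℕ => S - F ^ k * S * (F ^ k)ᵀ) atTop (𝓝 S) := by
    simpa only [sub_zero] using
      (tendsto_const_nhds (x := S)).sub (tendsto_pow_mul_mul_transpose_pow hF S)
  exact isClosed_setOf_posSemidef.mem_of_tendsto hlim (Eventually.of_forall h)

end Lyapunov

section Definiteness

open scoped ComplexOrder MatrixOrder

variable {n : Type*} [Fintype n]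

theorem Matrix.PosSemidef.map_ofReal {S : Matrix n n ℝ} (hS : S.PosSemidef) :
    (S.map Complex.ofReal).PosSemidef := by
  classical
  obtain ⟨B, rfl⟩ := CStarAlgebra.nonneg_iff_eq_star_mul_self.1 hS.nonneg
  have : (star B * B).map Complex.ofReal = (B.map Complex.ofReal)ᴴ * B.map Complex.ofReal := by
    ext i j
    simp [Matrix.mul_apply, Matrix.star_apply]
  rw [this]
  exact posSemidef_conjTranspose_mul_self _

/-- The kernel of a positive semidefinite solution of the Lyapunov equation is contained in that of
`Q` and is invariant under `Fᴴ`. -/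
theorem mulVec_eq_zero_of_eq_mul_mul_conjTranspose_add {F Q S : Matrix n n ℂ}
    (hQ : Q.PosSemidef) (hS : S.PosSemidef) (h : S = F * S * Fᴴ + Q) {x : n → ℂ}
    (hx : S *ᵥ x = 0) : S *ᵥ (Fᴴ *ᵥ x) = 0 ∧ Q *ᵥ x = 0 := by
  have hsum : star (Fᴴ *ᵥ x) ⬝ᵥ (S *ᵥ (Fᴴ *ᵥ x)) + star x ⬝ᵥ (Q *ᵥ x) = 0 := by
    calc _ = star x ⬝ᵥ ((F * S * Fᴴ + Q) *ᵥ x) := by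
          simp [add_mulVec, ← mulVec_mulVec, star_mulVec, dotProduct_mulVec, vecMul_vecMul]
      _ = 0 := by rw [← h, hx, dotProduct_zero]
  obtain ⟨h1, h2⟩ := (add_eq_zero_iff_of_nonneg (hS.dotProduct_mulVec_nonneg _)
    (hQ.dotProduct_mulVec_nonneg _)).1 hsum
  exact ⟨(hS.dotProduct_mulVec_zero_iff _).1 h1, (hQ.dotProduct_mulVec_zero_iff _).1 h2⟩

/-- A nonzero invariant kernel of a matrix contains an eigenvector. -/
theorem exists_eigenvector_of_invariant_ker {G S : Matrix n n ℂ}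
    (hinv : ∀ x, S *ᵥ x = 0 → S *ᵥ (G *ᵥ x) = 0) {v : n → ℂ} (hv : v ≠ 0) (hSv : S *ᵥ v = 0) :
    ∃ (μ : ℂ) (x : n → ℂ), x ≠ 0 ∧ S *ᵥ x = 0 ∧ G *ᵥ x = μ • x := by
  let W := LinearMap.ker S.mulVecLin
  let T : Module.End ℂ W := G.mulVecLin.restrict fun x hx => hinv x hx
  have : Nontrivial W := ⟨⟨⟨v, hSv⟩, 0, fun h => hv (congrArg Subtype.val h)⟩⟩
  obtain ⟨μ, hμ⟩ := Module.End.exists_eigenvalue T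
  obtain ⟨x, hx⟩ := hμ.exists_hasEigenvector
  exact ⟨μ, x, fun h => hx.2 (Subtype.ext h), x.2, congrArg Subtype.val hx.apply_eq_smul⟩

theorem Controllable.posDef_of_eq_mul_mul_transpose_add {m : ℕ}
    {F Q S : Matrix (Fin m) (Fin m) ℝ} (hc : Controllable F Q) (hQ : Q.PosSemidef)
    (hS : S.PosSemidef) (h : S = F * S * Fᵀ + Q) : S.PosDef := by
  rw [hS.posDef_iff_det_ne_zero]
  intro hdet
  have hdetC : (S.map Complex.ofReal).det = 0 := by
    have := (Complex.ofRealHom.map_det S).symm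
    rw [hdet, map_zero] at this
    exact this
  obtain ⟨v, hv, hSv⟩ := exists_mulVec_eq_zero_iff.2 hdetC
  have hFH : (F.map Complex.ofReal)ᴴ = (F.map Complex.ofReal)ᵀ := by
    ext i j
    simp
  have hC : S.map Complex.ofReal = F.map Complex.ofReal * S.map Complex.ofReal *
      (F.map Complex.ofReal)ᴴ + Q.map Complex.ofReal := by
    rw [hFH]
    have := congrArg Complex.ofRealHom.mapMatrix h
    rw [map_add, map_mul, map_mul] at this
    exact this
  have hker := fun x => mulVec_eq_zero_of_eq_mul_mul_conjTranspose_add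
    hQ.map_ofReal hS.map_ofReal hC (x := x)
  obtain ⟨μ, x, hx0, hSx, hFx⟩ :=
    exists_eigenvector_of_invariant_ker (fun x hx => (hker x hx).1) hv hSv
  refine hc μ x hx0 (by rw [← mulVec_transpose, ← hFH, hFx]) ?_
  have hQt : Qᵀ = Q := hQ.isHermitian
  rw [← mulVec_transpose, ← transpose_map, hQt]
  exact (hker x hSx).2

end Definiteness

/-- For a stable `F` and positive semidefinite `Q`, the discrete Lyapunov equation
`Σ = F Σ Fᵀ + Q` has a unique positive semidefinite solution, and if `(F, Q)` is
controllable this solution is positive definite (in particular invertible). -/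
theorem lyapunov_unique_psd_solution_and_posdef_of_controllable {m : ℕ}
    (F Q : Matrix (Fin m) (Fin m) ℝ)
    (hF : IsStableMatrix F) (hQ : Q.PosSemidef) :
    (∃! Sig : Matrix (Fin m) (Fin m) ℝ, Sig.PosSemidef ∧ Sig = F * Sig * Fᵀ + Q) ∧
    (Controllable F Q → ∀ Sig : Matrix (Fin m) (Fin m) ℝ,
      Sig.PosSemidef → Sig = F * Sig * Fᵀ + Q → Sig.PosDef) := by
  have hpow := hF.tendsto_pow
  refine ⟨?_, fun hc S hS h => hc.posDef_of_eq_mul_mul_transpose_add hQ hS h⟩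
  obtain ⟨S, hS⟩ := exists_eq_mul_mul_transpose_add hpow Q
  refine ⟨S, ⟨posSemidef_of_eq_mul_mul_transpose_add hpow hQ hS, hS⟩, ?_⟩
  rintro T ⟨-, hT⟩
  refine sub_eq_zero.1 (eq_zero_of_eq_mul_mul_transpose hpow ?_)
  calc T - S = (F * T * Fᵀ + Q) - (F * S * Fᵀ + Q) := by rw [← hT, ← hS]
    _ = F * (T - S) * Fᵀ := by rw [Matrix.mul_sub, Matrix.sub_mul]; abel
end

section
/- Let F ∈ ℝ^{m×m}, G ∈ ℝ^{m×1}, H ∈ ℝ^{1×m}, X ∈ ℝ^{1×m}, Γ ∈ ℝ^{m×1}, and let V > 0 be a real scalar. If the pair (F, G) is controllable, then the pair (F − Γ(X + H), (G − Γ)(G − Γ)ᵀ + V ΓΓᵀ) is controllable. -/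
open Matrix

open scoped ComplexOrder in
/-- A left null vector of a positive combination of two real Gram matrices is a left null vector of
both factors. -/
theorem vecMul_eq_zero_of_vecMul_gram_add_smul_gram {m r s : ℕ}
    (P : Matrix (Fin m) (Fin r) ℝ) (Q : Matrix (Fin m) (Fin s) ℝ) {V : ℝ} (hV : 0 < V)
    {x : Fin m → ℂ}
    (hx : x ᵥ* (P * Pᵀ + V • (Q * Qᵀ)).map Complex.ofReal = 0) :
    x ᵥ* P.map Complex.ofReal = 0 ∧ x ᵥ* Q.map Complex.ofReal = 0 := by
  have gram {k : ℕ} (C : Matrix (Fin m) (Fin k) ℂ) :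
      x ᵥ* (C * Cᴴ) ⬝ᵥ star x = (x ᵥ* C) ⬝ᵥ star (x ᵥ* C) := by
    rw [star_vecMul, ← vecMul_vecMul, ← dotProduct_mulVec]
  have map_eq : (P * Pᵀ + V • (Q * Qᵀ)).map Complex.ofReal =
      P.map Complex.ofReal * (P.map Complex.ofReal)ᴴ +
        (V : ℂ) • (Q.map Complex.ofReal * (Q.map Complex.ofReal)ᴴ) := by
    ext i j
    simp [mul_apply]
  have hV' : (0 : ℂ) < V := by exact_mod_cast hV
  have key : (x ᵥ* P.map Complex.ofReal) ⬝ᵥ star (x ᵥ* P.map Complex.ofReal) +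
      (V : ℂ) * ((x ᵥ* Q.map Complex.ofReal) ⬝ᵥ star (x ᵥ* Q.map Complex.ofReal)) = 0 := by
    rw [← gram, ← gram, ← smul_eq_mul, ← smul_dotProduct, ← vecMul_smul, ← add_dotProduct,
      ← vecMul_add, ← map_eq, hx, zero_dotProduct]
  have hP := dotProduct_self_star_nonneg (x ᵥ* P.map Complex.ofReal)
  have hQ := mul_nonneg hV'.le (dotProduct_self_star_nonneg (x ᵥ* Q.map Complex.ofReal))
  obtain ⟨h₁, h₂⟩ := (add_eq_zero_iff_of_nonneg hP hQ).1 key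
  exact ⟨dotProduct_self_star_eq_zero.1 h₁,
    dotProduct_self_star_eq_zero.1 ((mul_eq_zero.1 h₂).resolve_left hV'.ne')⟩

/-- If `(F, G)` is controllable and `V > 0`, then the pair
`(F − Γ(X + H), (G − Γ)(G − Γ)ᵀ + V ΓΓᵀ)` is controllable. -/
theorem controllable_closed_loop {m : ℕ}
    (F : Matrix (Fin m) (Fin m) ℝ) (G Γ : Matrix (Fin m) (Fin 1) ℝ)
    (H X : Matrix (Fin 1) (Fin m) ℝ) (V : ℝ) (hV : 0 < V)
    (hFG : Controllable F G) :
    Controllable (F - Γ * (X + H)) ((G - Γ) * (G - Γ)ᵀ + V • (Γ * Γᵀ)) := by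
  intro μ x hx hA hB
  obtain ⟨hP, hΓ⟩ := vecMul_eq_zero_of_vecMul_gram_add_smul_gram _ _ hV hB
  refine hFG μ x hx ?_ ?_
  · have hF : (F - Γ * (X + H)).map Complex.ofReal =
        F.map Complex.ofReal - Γ.map Complex.ofReal * (X + H).map Complex.ofReal := by
      ext i j
      simp [mul_apply]
    rwa [hF, vecMul_sub, ← vecMul_vecMul, hΓ, zero_vecMul, sub_zero] at hA
  · have hG : G.map Complex.ofReal = (G - Γ).map Complex.ofReal + Γ.map Complex.ofReal := by
      ext i j
      simp
    rw [hG, vecMul_add, hP, hΓ, add_zero]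
end

section
/- Let F ∈ ℝ^{m×m}, G ∈ ℝ^{m×1}, H ∈ ℝ^{1×m}, X ∈ ℝ^{1×m}, Γ ∈ ℝ^{m×1}, and let V > 0 be a real scalar. Suppose the pair (F, G) is controllable, and suppose Σ ∈ ℝ^{m×m} is a symmetric positive semidefinite matrix satisfying the Riccati equation Σ = (F − Γ(X + H)) Σ (F − Γ(X + H))ᵀ + (G − Γ)(G − Γ)ᵀ + V ΓΓᵀ. Then the matrix F − Γ(X + H) is stable, i.e., all of its complex eigenvalues have modulus strictly less than 1. -/
open Matrix

section

open scoped ComplexOrder MatrixOrder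

/-- If `S` solves the Stein equation `S = A S Aᴴ + R` and `y` is a left eigenvector of `A` for an
eigenvalue of modulus at least `1`, then the quadratic form of `R` is nonpositive at `y`. -/
theorem stein_quadraticForm_nonpos {n : Type*} [Fintype n] {A S R : Matrix n n ℂ}
    (hS : S.PosSemidef) (h : S = A * S * Aᴴ + R) {y : n → ℂ} {μ : ℂ}
    (hy : star y ᵥ* A = μ • star y) (hμ : 1 ≤ ‖μ‖) :
    (star y ⬝ᵥ (R *ᵥ y)).re ≤ 0 := by
  have hy' : Aᴴ *ᵥ y = star μ • y := by
    rw [← star_star y, ← star_vecMul, hy, star_smul]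
  have hq : 0 ≤ (star y ⬝ᵥ (S *ᵥ y)).re :=
    (Complex.le_def.1 (hS.dotProduct_mulVec_nonneg y)).1
  have e : star y ⬝ᵥ (S *ᵥ y)
      = ((‖μ‖ ^ 2 : ℝ) : ℂ) * (star y ⬝ᵥ (S *ᵥ y)) + star y ⬝ᵥ (R *ᵥ y) := by
    conv_lhs => rw [h]
    rw [add_mulVec, dotProduct_add, ← mulVec_mulVec, ← mulVec_mulVec, dotProduct_mulVec, hy, hy',
      mulVec_smul, dotProduct_smul, smul_dotProduct, smul_eq_mul, smul_eq_mul, ← mul_assoc]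
    congr 2
    rw [mul_comm]
    simpa using Complex.mul_conj' μ
  have e' := congrArg Complex.re e
  rw [Complex.add_re, Complex.re_ofReal_mul] at e'
  nlinarith [one_le_pow₀ hμ (n := 2)]

/-- The quadratic form of `N Nᴴ` is a squared norm. -/
theorem dotProduct_mul_conjTranspose_mulVec {n k : Type*} [Fintype n] [Fintype k]
    (N : Matrix n k ℂ) (y : n → ℂ) :
    star y ⬝ᵥ ((N * Nᴴ) *ᵥ y) = (star y ᵥ* N) ⬝ᵥ star (star y ᵥ* N) := by
  rw [← mulVec_mulVec, dotProduct_mulVec, star_vecMul, star_star]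

/-- A real positive semidefinite matrix is positive semidefinite over `ℂ`. -/
theorem Matrix.PosSemidef.map_complexOfReal {n : Type*} [Fintype n] {S : Matrix n n ℝ}
    (hS : S.PosSemidef) : (S.map Complex.ofReal).PosSemidef := by
  classical
  obtain ⟨B, rfl⟩ := CStarAlgebra.nonneg_iff_eq_star_mul_self.1 hS.nonneg
  rw [star_eq_conjTranspose]
  have e : (Bᴴ * B).map Complex.ofReal = (B.map Complex.ofReal)ᴴ * B.map Complex.ofReal := by
    ext i j
    simp [mul_apply]
  rw [e]
  exact posSemidef_conjTranspose_mul_self _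

theorem dotProduct_self_star_re_nonneg {n : Type*} [Fintype n] (w : n → ℂ) :
    0 ≤ (w ⬝ᵥ star w).re :=
  (Complex.le_def.1 (dotProduct_self_star_nonneg w)).1

theorem eq_zero_of_dotProduct_self_star_re {n : Type*} [Fintype n] (w : n → ℂ)
    (hw : (w ⬝ᵥ star w).re = 0) : w = 0 :=
  dotProduct_self_star_eq_zero.1
    (Complex.ext hw (Complex.le_def.1 (dotProduct_self_star_nonneg w)).2.symm)

end

/-- Every eigenvalue of a square matrix has a left eigenvector. -/
theorem exists_left_eigenvector {n K : Type*} [Fintype n] [Field K]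
    {A : Matrix n n K} {μ : K} {v : n → K} (hv : v ≠ 0) (h : A *ᵥ v = μ • v) :
    ∃ x : n → K, x ≠ 0 ∧ x ᵥ* A = μ • x := by
  classical
  have hdet : (A - μ • (1 : Matrix n n K)).det = 0 :=
    exists_mulVec_eq_zero_iff.1 ⟨v, hv, by simp [sub_mulVec, h, smul_mulVec]⟩
  obtain ⟨x, hx, hx0⟩ := exists_vecMul_eq_zero_iff.2 hdet
  exact ⟨x, hx, sub_eq_zero.1 (by simpa [vecMul_sub, vecMul_smul] using hx0)⟩

/-- If `(F, G)` is controllable, `V > 0`, and the positive semidefinite `Σ` satisfies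
the Riccati equation
`Σ = (F − Γ(X+H)) Σ (F − Γ(X+H))ᵀ + (G − Γ)(G − Γ)ᵀ + V ΓΓᵀ`,
then the closed-loop matrix `F − Γ(X+H)` is stable. -/
theorem stable_closed_loop_of_riccati {m : ℕ}
    (F : Matrix (Fin m) (Fin m) ℝ) (G Γ : Matrix (Fin m) (Fin 1) ℝ)
    (H X : Matrix (Fin 1) (Fin m) ℝ) (V : ℝ) (hV : 0 < V)
    (hFG : Controllable F G)
    (Sig : Matrix (Fin m) (Fin m) ℝ) (hSig : Sig.PosSemidef)
    (hricc : Sig = (F - Γ * (X + H)) * Sig * (F - Γ * (X + H))ᵀ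
        + (G - Γ) * (G - Γ)ᵀ + V • (Γ * Γᵀ)) :
    IsStableMatrix (F - Γ * (X + H)) := by
  intro μ v hv hev
  by_contra! hμ
  obtain ⟨x, hx, hxA⟩ := exists_left_eigenvector hv hev
  set A := F - Γ * (X + H) with hA
  set g : Matrix (Fin m) (Fin 1) ℂ := (G - Γ).map Complex.ofReal with hg
  set γ : Matrix (Fin m) (Fin 1) ℂ := Γ.map Complex.ofReal with hγ
  have hric : Sig.map Complex.ofReal
      = A.map Complex.ofReal * Sig.map Complex.ofReal * (A.map Complex.ofReal)ᴴ
        + (g * gᴴ + (V : ℂ) • (γ * γᴴ)) := by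
    conv_lhs => rw [hricc]
    ext i j
    simp [hg, hγ, mul_apply, add_assoc]
  have key := stein_quadraticForm_nonpos hSig.map_complexOfReal hric (y := star x)
    (by rwa [star_star]) hμ
  rw [add_mulVec, smul_mulVec, dotProduct_add, dotProduct_smul,
    dotProduct_mul_conjTranspose_mulVec, dotProduct_mul_conjTranspose_mulVec, star_star,
    smul_eq_mul, Complex.add_re, Complex.re_ofReal_mul] at key
  have hxγ : x ᵥ* γ = 0 := by
    refine eq_zero_of_dotProduct_self_star_re _ ?_
    nlinarith [dotProduct_self_star_re_nonneg (x ᵥ* g), dotProduct_self_star_re_nonneg (x ᵥ* γ)]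
  have hxg : x ᵥ* g = 0 := by
    refine eq_zero_of_dotProduct_self_star_re _ ?_
    nlinarith [dotProduct_self_star_re_nonneg (x ᵥ* g),
      mul_nonneg hV.le (dotProduct_self_star_re_nonneg (x ᵥ* γ))]
  have hG : G.map Complex.ofReal = g + γ := by
    ext i j
    simp [hg, hγ]
  have hF : F.map Complex.ofReal = A.map Complex.ofReal + γ * (X + H).map Complex.ofReal := by
    ext i j
    simp [hA, hγ, mul_apply]
  refine hFG μ x hx ?_ ?_
  · rw [hF, vecMul_add, ← vecMul_vecMul, hxγ, zero_vecMul, add_zero, hxA]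
  · rw [hG, vecMul_add, hxg, hxγ, add_zero]
end

section
/- Let F ∈ ℝ^{m×m}, G ∈ ℝ^{m×1}, H ∈ ℝ^{1×m}, X ∈ ℝ^{1×m}, Γ ∈ ℝ^{m×1}, and let V > 0 be a real scalar. Suppose the pair (F, G) is controllable, and suppose Σ ∈ ℝ^{m×m} is a symmetric positive semidefinite matrix satisfying the Riccati equation Σ = (F − Γ(X + H)) Σ (F − Γ(X + H))ᵀ + (G − Γ)(G − Γ)ᵀ + V ΓΓᵀ. Then Σ is positive definite (in particular, Σ is invertible). -/
open Matrix

/-- The kernel of a positive semidefinite solution of the Riccati equation is invariant under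
`Fᵀ` and annihilated by `Gᵀ`. -/
theorem ker_riccati {m : ℕ}
    {F : Matrix (Fin m) (Fin m) ℝ} {G Γ : Matrix (Fin m) (Fin 1) ℝ}
    {L : Matrix (Fin 1) (Fin m) ℝ} {V : ℝ} (hV : 0 < V)
    {S : Matrix (Fin m) (Fin m) ℝ} (hS : S.PosSemidef)
    (h : S = (F - Γ * L) * S * (F - Γ * L)ᵀ + (G - Γ) * (G - Γ)ᵀ + V • (Γ * Γᵀ))
    {x : Fin m → ℝ} (hx : S *ᵥ x = 0) :
    S *ᵥ (x ᵥ* F) = 0 ∧ x ᵥ* G = 0 := by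
  set y := x ᵥ* (F - Γ * L) with hy
  have key : x ⬝ᵥ S *ᵥ x = y ⬝ᵥ S *ᵥ y
      + (x ᵥ* (G - Γ)) ⬝ᵥ (x ᵥ* (G - Γ)) + V * ((x ᵥ* Γ) ⬝ᵥ (x ᵥ* Γ)) := by
    conv_lhs => rw [h]
    simp only [add_mulVec, smul_mulVec, dotProduct_add, dotProduct_smul, smul_eq_mul,
      ← mulVec_mulVec, mulVec_transpose, dotProduct_mulVec, hy]
  rw [hx, dotProduct_zero] at key
  have h1 : 0 ≤ y ⬝ᵥ S *ᵥ y := by simpa using hS.dotProduct_mulVec_nonneg y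
  have h2 : 0 ≤ (x ᵥ* (G - Γ)) ⬝ᵥ (x ᵥ* (G - Γ)) :=
    Finset.sum_nonneg fun i _ => mul_self_nonneg _
  have h3 : 0 ≤ (x ᵥ* Γ) ⬝ᵥ (x ᵥ* Γ) := Finset.sum_nonneg fun i _ => mul_self_nonneg _
  have h3' : 0 ≤ V * ((x ᵥ* Γ) ⬝ᵥ (x ᵥ* Γ)) := mul_nonneg hV.le h3
  have e1 : y ⬝ᵥ S *ᵥ y = 0 := by linarith
  have e2 : x ᵥ* (G - Γ) = 0 := dotProduct_self_eq_zero.1 (by linarith)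
  have e3 : x ᵥ* Γ = 0 := by
    have : V * ((x ᵥ* Γ) ⬝ᵥ (x ᵥ* Γ)) = 0 := by linarith
    exact dotProduct_self_eq_zero.1 ((mul_eq_zero.1 this).resolve_left hV.ne')
  have hyF : y = x ᵥ* F := by
    rw [hy, vecMul_sub, ← vecMul_vecMul, e3, zero_vecMul, sub_zero]
  refine ⟨?_, ?_⟩
  · rw [← hyF]
    exact (hS.dotProduct_mulVec_zero_iff y).1 (by simpa using e1)
  · rwa [vecMul_sub, e3, sub_zero] at e2

theorem map_ofReal_mulVec_eq_zero_iff {m n : ℕ} (A : Matrix (Fin m) (Fin n) ℝ) (z : Fin n → ℂ) :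
    A.map Complex.ofReal *ᵥ z = 0 ↔
      A *ᵥ (fun i => (z i).re) = 0 ∧ A *ᵥ (fun i => (z i).im) = 0 := by
  simp [funext_iff, mulVec, dotProduct, Complex.ext_iff, forall_and]

theorem re_vecMul_map_ofReal {m n : ℕ} (A : Matrix (Fin m) (Fin n) ℝ) (z : Fin m → ℂ) :
    (fun j => ((z ᵥ* A.map Complex.ofReal) j).re) = (fun i => (z i).re) ᵥ* A := by
  ext j
  simp [vecMul, dotProduct]

theorem im_vecMul_map_ofReal {m n : ℕ} (A : Matrix (Fin m) (Fin n) ℝ) (z : Fin m → ℂ) :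
    (fun j => ((z ᵥ* A.map Complex.ofReal) j).im) = (fun i => (z i).im) ᵥ* A := by
  ext j
  simp [vecMul, dotProduct]

/-- If `(F, G)` is controllable, `V > 0`, and the positive semidefinite `Σ` satisfies
the Riccati equation
`Σ = (F − Γ(X+H)) Σ (F − Γ(X+H))ᵀ + (G − Γ)(G − Γ)ᵀ + V ΓΓᵀ`,
then `Σ` is positive definite (in particular invertible). -/
theorem posdef_of_riccati {m : ℕ}
    (F : Matrix (Fin m) (Fin m) ℝ) (G Γ : Matrix (Fin m) (Fin 1) ℝ)
    (H X : Matrix (Fin 1) (Fin m) ℝ) (V : ℝ) (hV : 0 < V)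
    (hFG : Controllable F G)
    (Sig : Matrix (Fin m) (Fin m) ℝ) (hSig : Sig.PosSemidef)
    (hricc : Sig = (F - Γ * (X + H)) * Sig * (F - Γ * (X + H))ᵀ
        + (G - Γ) * (G - Γ)ᵀ + V • (Γ * Γᵀ)) :
    Sig.PosDef := by
  rw [hSig.posDef_iff_isUnit, ← mulVec_injective_iff_isUnit]
  refine (injective_iff_map_eq_zero Sig.mulVecLin).2 fun x hx => ?_
  by_contra hx0
  let K : Submodule ℂ (Fin m → ℂ) := LinearMap.ker (Sig.map Complex.ofReal).mulVecLin
  have hK (z : Fin m → ℂ) (hz : z ∈ K) :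
      z ᵥ* F.map Complex.ofReal ∈ K ∧ z ᵥ* G.map Complex.ofReal = 0 := by
    obtain ⟨hre, him⟩ := (map_ofReal_mulVec_eq_zero_iff Sig z).1 hz
    obtain ⟨hre, hreG⟩ := ker_riccati hV hSig hricc hre
    obtain ⟨him, himG⟩ := ker_riccati hV hSig hricc him
    refine ⟨(map_ofReal_mulVec_eq_zero_iff Sig _).2 ⟨?_, ?_⟩, ?_⟩
    · rwa [re_vecMul_map_ofReal]
    · rwa [im_vecMul_map_ofReal]
    · rw [← re_vecMul_map_ofReal] at hreG
      rw [← im_vecMul_map_ofReal] at himG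
      exact funext fun j => Complex.ext (congrFun hreG j) (congrFun himG j)
  have hxK : (fun i => (x i : ℂ)) ∈ K :=
    (map_ofReal_mulVec_eq_zero_iff Sig _).2 ⟨by simpa using hx, mulVec_zero Sig⟩
  have : Nontrivial K := by
    refine ⟨⟨_, hxK⟩, 0, fun h => hx0 (funext fun i => ?_)⟩
    simpa using congrFun (congrArg Subtype.val h) i
  obtain ⟨μ, hμ⟩ := Module.End.exists_eigenvalue
    ((F.map Complex.ofReal).vecMulLinear.restrict fun z hz => (hK z hz).1 : Module.End ℂ K)
  obtain ⟨z, hz⟩ := hμ.exists_hasEigenvector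
  exact hFG μ z (fun h => hz.2 (Subtype.ext h)) (congrArg Subtype.val hz.apply_eq_smul)
    (hK z z.2).2
end

section
/- Let F ∈ ℝ^{m×m}, G ∈ ℝ^{m×1}, H ∈ ℝ^{1×m}, and P > 0. Define S₁ = { Y ∈ ℝ : there exist V > 0, K ∈ ℝ^{1×m}, a symmetric Σ ≻ 0, and Γ ∈ ℝ^{m×1} with P ≥ KΣ^{-1}Kᵀ + V, Σ ⪯ FΣFᵀ + GGᵀ − Y ΓΓᵀ, Γ = (FKᵀ + FΣHᵀ + G) Y^{-1}, and Y = KΣ^{-1}Kᵀ + KHᵀ + HKᵀ + HΣHᵀ + V + 1 }, and define S₂ to be the same set with the power constraint replaced by the equality P = KΣ^{-1}Kᵀ + V (so that Y = KHᵀ + HKᵀ + HΣHᵀ + P + 1). If both sets are nonempty and bounded above, then sup S₁ = sup S₂; i.e., at the optimum the power constraint can be taken to hold with equality. -/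
open Matrix

/-- Feasible set with the power *inequality* `P ≥ K Σ⁻¹ Kᵀ + V`. -/
def SOne {m : ℕ} (F : Matrix (Fin m) (Fin m) ℝ) (G : Matrix (Fin m) (Fin 1) ℝ)
    (H : Matrix (Fin 1) (Fin m) ℝ) (P : ℝ) : Set ℝ :=
  { Y | ∃ (V : ℝ) (K : Matrix (Fin 1) (Fin m) ℝ)
      (Sig : Matrix (Fin m) (Fin m) ℝ) (Γ : Matrix (Fin m) (Fin 1) ℝ),
      0 < V ∧ Sig.PosDef ∧
      (K * Sig⁻¹ * Kᵀ) 0 0 + V ≤ P ∧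
      (F * Sig * Fᵀ + G * Gᵀ - Y • (Γ * Γᵀ) - Sig).PosSemidef ∧
      Γ = Y⁻¹ • (F * Kᵀ + F * Sig * Hᵀ + G) ∧
      Y = (K * Sig⁻¹ * Kᵀ) 0 0 + (K * Hᵀ) 0 0 + (H * Kᵀ) 0 0
            + (H * Sig * Hᵀ) 0 0 + V + 1 }

/-- Feasible set with the power constraint holding with *equality*
`P = K Σ⁻¹ Kᵀ + V` (so that `Y = KHᵀ + HKᵀ + HΣHᵀ + P + 1`). -/
def STwo {m : ℕ} (F : Matrix (Fin m) (Fin m) ℝ) (G : Matrix (Fin m) (Fin 1) ℝ)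
    (H : Matrix (Fin 1) (Fin m) ℝ) (P : ℝ) : Set ℝ :=
  { Y | ∃ (V : ℝ) (K : Matrix (Fin 1) (Fin m) ℝ)
      (Sig : Matrix (Fin m) (Fin m) ℝ) (Γ : Matrix (Fin m) (Fin 1) ℝ),
      0 < V ∧ Sig.PosDef ∧
      (K * Sig⁻¹ * Kᵀ) 0 0 + V = P ∧
      (F * Sig * Fᵀ + G * Gᵀ - Y • (Γ * Γᵀ) - Sig).PosSemidef ∧
      Γ = Y⁻¹ • (F * Kᵀ + F * Sig * Hᵀ + G) ∧
      Y = (K * Hᵀ) 0 0 + (H * Kᵀ) 0 0 + (H * Sig * Hᵀ) 0 0 + P + 1 }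

/-- The output variance `K Σ⁻¹ Kᵀ + K Hᵀ + H Kᵀ + H Σ Hᵀ` is a completed square,
hence nonnegative. -/
theorem signal_variance_nonneg {m : ℕ} (H K : Matrix (Fin 1) (Fin m) ℝ)
    {Sig : Matrix (Fin m) (Fin m) ℝ} (hS : Sig.PosDef) :
    0 ≤ (K * Sig⁻¹ * Kᵀ) 0 0 + (K * Hᵀ) 0 0 + (H * Kᵀ) 0 0 + (H * Sig * Hᵀ) 0 0 := by
  have hu : IsUnit Sig.det := (Matrix.isUnit_iff_isUnit_det _).1 hS.isUnit
  have hsymm : Sigᵀ = Sig := by simpa [conjTranspose_eq_transpose_of_trivial] using hS.isHermitian.eq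
  have hpsd := hS.inv.posSemidef.mul_mul_conjTranspose_same (K + H * Sig)
  have hexp : (K + H * Sig) * Sig⁻¹ * (K + H * Sig)ᴴ
      = K * Sig⁻¹ * Kᵀ + K * Hᵀ + H * Kᵀ + H * Sig * Hᵀ := by
    have hcancel : (K + H * Sig) * Sig⁻¹ = K * Sig⁻¹ + H := by
      rw [Matrix.add_mul, Matrix.mul_assoc H, Matrix.mul_nonsing_inv _ hu, Matrix.mul_one]
    have hK : K * Sig⁻¹ * (Sig * Hᵀ) = K * Hᵀ := by
      rw [← Matrix.mul_assoc, Matrix.mul_assoc K, Matrix.nonsing_inv_mul _ hu, Matrix.mul_one]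
    rw [hcancel, conjTranspose_eq_transpose_of_trivial, transpose_add, transpose_mul, hsymm,
      Matrix.mul_add, Matrix.add_mul, Matrix.add_mul, hK, ← Matrix.mul_assoc H]
    abel
  rw [hexp] at hpsd
  exact hpsd.diag_nonneg (i := 0)

/-- Shrinking the coefficient of a subtracted Gram matrix preserves positive semidefiniteness. -/
theorem posSemidef_sub_gain_mono {m : ℕ} {A B : Matrix (Fin m) (Fin m) ℝ}
    {N : Matrix (Fin m) (Fin 1) ℝ} {Y Z : ℝ} (hY : 0 < Y) (hYZ : Y ≤ Z)
    (h : (A - Y • ((Y⁻¹ • N) * (Y⁻¹ • N)ᵀ) - B).PosSemidef) :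
    (A - Z • ((Z⁻¹ • N) * (Z⁻¹ • N)ᵀ) - B).PosSemidef := by
  have hgram (t : ℝ) (ht : 0 < t) :
      t • ((t⁻¹ • N) * (t⁻¹ • N)ᵀ) = t⁻¹ • (N * Nᵀ) := by
    simp [smul_smul, ht.ne']
  have hN : (N * Nᵀ).PosSemidef := by
    simpa [conjTranspose_eq_transpose_of_trivial] using posSemidef_self_mul_conjTranspose N
  have hcoef : 0 ≤ Y⁻¹ - Z⁻¹ := sub_nonneg.2 (inv_anti₀ hY hYZ)
  have hsum := h.add (hN.smul hcoef)
  rw [hgram Y hY] at hsum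
  rw [hgram Z (hY.trans_le hYZ)]
  convert hsum using 1
  rw [sub_smul]
  abel

theorem STwo_subset_SOne {m : ℕ} (F : Matrix (Fin m) (Fin m) ℝ) (G : Matrix (Fin m) (Fin 1) ℝ)
    (H : Matrix (Fin 1) (Fin m) ℝ) (P : ℝ) : STwo F G H P ⊆ SOne F G H P := by
  rintro Y ⟨V, K, Sig, Γ, hV, hS, hpow, hpsd, hΓ, hY⟩
  exact ⟨V, K, Sig, Γ, hV, hS, hpow.le, hpsd, hΓ, by linarith⟩

/-- Spending the unused power on `V` only increases the objective. -/
theorem exists_mem_STwo_ge {m : ℕ} {F : Matrix (Fin m) (Fin m) ℝ} {G : Matrix (Fin m) (Fin 1) ℝ}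
    {H : Matrix (Fin 1) (Fin m) ℝ} {P Y : ℝ} (h : Y ∈ SOne F G H P) :
    ∃ Z ∈ STwo F G H P, Y ≤ Z := by
  obtain ⟨V, K, Sig, Γ, hV, hS, hpow, hpsd, rfl, hY⟩ := h
  have hvar := signal_variance_nonneg H K hS
  have hYZ : Y ≤ (K * Hᵀ) 0 0 + (H * Kᵀ) 0 0 + (H * Sig * Hᵀ) 0 0 + P + 1 := by linarith
  exact ⟨_, ⟨P - (K * Sig⁻¹ * Kᵀ) 0 0, K, Sig, _, by linarith, hS, by ring,
    posSemidef_sub_gain_mono (by linarith) hYZ hpsd, rfl, rfl⟩, hYZ⟩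

/-- At the optimum, the power constraint can be taken to hold with equality. -/
theorem sup_power_ineq_eq_sup_power_eq {m : ℕ}
    (F : Matrix (Fin m) (Fin m) ℝ) (G : Matrix (Fin m) (Fin 1) ℝ)
    (H : Matrix (Fin 1) (Fin m) ℝ) (P : ℝ) (hP : 0 < P)
    (hne₁ : (SOne F G H P).Nonempty) (hne₂ : (STwo F G H P).Nonempty)
    (hbdd₁ : BddAbove (SOne F G H P)) (hbdd₂ : BddAbove (STwo F G H P)) :
    sSup (SOne F G H P) = sSup (STwo F G H P) := by
  refine le_antisymm (csSup_le hne₁ fun Y hY => ?_)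
    (csSup_le_csSup hbdd₁ hne₂ (STwo_subset_SOne F G H P))
  obtain ⟨Z, hZ, hYZ⟩ := exists_mem_STwo_ge hY
  exact hYZ.trans (le_csSup hbdd₂ hZ)
end

section
/- Let F ∈ ℝ^{m×m}, G ∈ ℝ^{m×1}, H ∈ ℝ^{1×m}, and P > 0. Define the feasible set S = { Y ∈ ℝ : there exist V > 0, X ∈ ℝ^{1×m}, a symmetric Σ ≻ 0, and Γ ∈ ℝ^{m×1} with P ≥ XΣXᵀ + V, Σ ⪯ FΣFᵀ + GGᵀ − Y ΓΓᵀ, Γ = (FΣ(X+H)ᵀ + G) Y^{-1}, and Y = (X+H)Σ(X+H)ᵀ + V + 1 }, and define the SDP feasible set T = { Y ∈ ℝ : there exist K ∈ ℝ^{1×m} and a symmetric Σ ≻ 0 such that the 2×2 block matrix [[P, K], [Kᵀ, Σ]] is positive definite, the block matrix [[FΣFᵀ − Σ + GGᵀ, FKᵀ + FΣHᵀ + G], [(FKᵀ + FΣHᵀ + G)ᵀ, Y]] is positive semidefinite, and Y = KHᵀ + HKᵀ + HΣHᵀ + P + 1 }. If both sets are nonempty and bounded above, then sup S = sup T; i.e.,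 the stationary feedback-capacity optimization problem is equivalent to the semidefinite program, and the feedback capacity equals (1/2)log₂(sup T). -/
open Matrix

/-- Feasible set of the stationary feedback-capacity optimization problem
(with `Σ ≻ 0` and the relaxed Riccati inequality). -/
def SCap {m : ℕ} (F : Matrix (Fin m) (Fin m) ℝ) (G : Matrix (Fin m) (Fin 1) ℝ)
    (H : Matrix (Fin 1) (Fin m) ℝ) (P : ℝ) : Set ℝ :=
  { Y | ∃ (V : ℝ) (X : Matrix (Fin 1) (Fin m) ℝ)
      (Sig : Matrix (Fin m) (Fin m) ℝ) (Γ : Matrix (Fin m) (Fin 1) ℝ),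
      0 < V ∧ Sig.PosDef ∧
      (X * Sig * Xᵀ) 0 0 + V ≤ P ∧
      (F * Sig * Fᵀ + G * Gᵀ - Y • (Γ * Γᵀ) - Sig).PosSemidef ∧
      Γ = Y⁻¹ • (F * Sig * (X + H)ᵀ + G) ∧
      Y = ((X + H) * Sig * (X + H)ᵀ) 0 0 + V + 1 }

/-- Feasible set of the equivalent semidefinite program. -/
def TSdp {m : ℕ} (F : Matrix (Fin m) (Fin m) ℝ) (G : Matrix (Fin m) (Fin 1) ℝ)
    (H : Matrix (Fin 1) (Fin m) ℝ) (P : ℝ) : Set ℝ :=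
  { Y | ∃ (K : Matrix (Fin 1) (Fin m) ℝ) (Sig : Matrix (Fin m) (Fin m) ℝ),
      Sig.PosDef ∧
      (Matrix.fromBlocks (Matrix.of fun _ _ => P) K Kᵀ Sig).PosDef ∧
      (Matrix.fromBlocks (F * Sig * Fᵀ - Sig + G * Gᵀ)
          (F * Kᵀ + F * Sig * Hᵀ + G)
          (F * Kᵀ + F * Sig * Hᵀ + G)ᵀ
          (Matrix.of fun _ _ => Y)).PosSemidef ∧
      Y = (K * Hᵀ) 0 0 + (H * Kᵀ) 0 0 + (H * Sig * Hᵀ) 0 0 + P + 1 }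

theorem Matrix.PosDef.fromBlocks₂₂_iff {m n : Type*} [Fintype m] [Fintype n] [DecidableEq m]
    [DecidableEq n] (A : Matrix m m ℝ) (B : Matrix m n ℝ) {D : Matrix n n ℝ} (hD : D.PosDef) :
    (fromBlocks A B Bᵀ D).PosDef ↔ (A - B * D⁻¹ * Bᵀ).PosDef := by
  let := hD.isUnit.invertible
  have hpsd : (fromBlocks A B Bᵀ D).PosSemidef ↔ (A - B * D⁻¹ * Bᵀ).PosSemidef := by
    simpa only [conjTranspose_eq_transpose_of_trivial] using PosDef.fromBlocks₂₂ A B hD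
  have hunit : IsUnit (fromBlocks A B Bᵀ D) ↔ IsUnit (A - B * D⁻¹ * Bᵀ) := by
    rw [isUnit_fromBlocks_iff_of_invertible₂₂, invOf_eq_nonsing_inv]
  constructor
  · intro h
    exact (hpsd.1 h.posSemidef).posDef_iff_isUnit.2 (hunit.1 h.isUnit)
  · intro h
    exact (hpsd.2 h.posSemidef).posDef_iff_isUnit.2 (hunit.2 h.isUnit)

theorem Matrix.posDef_fin_one_iff (A : Matrix (Fin 1) (Fin 1) ℝ) : A.PosDef ↔ 0 < A 0 0 := by
  have hA : A = diagonal fun i => A i i := by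
    ext i j
    obtain rfl : i = j := Subsingleton.elim i j
    simp
  rw [hA, posDef_diagonal_iff]
  simp

theorem posDef_power_block_iff {m : ℕ} {Sig : Matrix (Fin m) (Fin m) ℝ} (hSig : Sig.PosDef)
    (P : ℝ) (X : Matrix (Fin 1) (Fin m) ℝ) :
    (fromBlocks (of fun _ _ => P) (X * Sig) (X * Sig)ᵀ Sig).PosDef ↔
      (X * Sig * Xᵀ) 0 0 < P := by
  have hT : Sigᵀ = Sig := hSig.isHermitian
  have hdet : IsUnit Sig.det := (isUnit_iff_isUnit_det _).1 hSig.isUnit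
  have h : X * Sig * Sig⁻¹ * (X * Sig)ᵀ = X * Sig * Xᵀ := by
    rw [mul_nonsing_inv_cancel_right _ _ hdet, transpose_mul, hT, Matrix.mul_assoc]
  rw [PosDef.fromBlocks₂₂_iff _ _ hSig, h, posDef_fin_one_iff]
  simp

theorem posSemidef_riccati_block_iff {n : Type*} [Fintype n] [DecidableEq n] {Y : ℝ}
    (hY : 0 < Y) (A : Matrix n n ℝ) (L : Matrix n (Fin 1) ℝ) :
    (fromBlocks A L Lᵀ (of fun _ _ => Y)).PosSemidef ↔ (A - Y⁻¹ • (L * Lᵀ)).PosSemidef := by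
  have hD : (of fun _ _ => Y : Matrix (Fin 1) (Fin 1) ℝ).PosDef := by
    rw [posDef_fin_one_iff]
    simpa using hY
  let := hD.isUnit.invertible
  have hinv : (of fun _ _ => Y : Matrix (Fin 1) (Fin 1) ℝ)⁻¹ = Y⁻¹ • 1 := by
    apply inv_eq_right_inv
    ext i j
    fin_cases i
    fin_cases j
    simp [Matrix.mul_apply, hY.ne']
  have h := PosDef.fromBlocks₂₂ A L hD
  rw [hinv] at h
  simpa only [conjTranspose_eq_transpose_of_trivial, Matrix.mul_smul, Matrix.mul_one,
    Matrix.smul_mul] using h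

theorem riccati_slack_eq {m : ℕ} {Y : ℝ} (hY : Y ≠ 0) (F Sig : Matrix (Fin m) (Fin m) ℝ)
    (G L : Matrix (Fin m) (Fin 1) ℝ) :
    F * Sig * Fᵀ + G * Gᵀ - Y • ((Y⁻¹ • L) * (Y⁻¹ • L)ᵀ) - Sig =
      F * Sig * Fᵀ - Sig + G * Gᵀ - Y⁻¹ • (L * Lᵀ) := by
  rw [transpose_smul, Matrix.smul_mul, Matrix.mul_smul, smul_smul, smul_smul,
    mul_inv_cancel₀ hY, one_mul]
  abel

theorem cross_term_eq {m : ℕ} {F Sig : Matrix (Fin m) (Fin m) ℝ} (hT : Sigᵀ = Sig)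
    (G : Matrix (Fin m) (Fin 1) ℝ) (H X : Matrix (Fin 1) (Fin m) ℝ) :
    F * (X * Sig)ᵀ + F * Sig * Hᵀ + G = F * Sig * (X + H)ᵀ + G := by
  rw [transpose_mul, transpose_add, hT, Matrix.mul_add, ← Matrix.mul_assoc]

theorem output_power_eq {m : ℕ} {Sig : Matrix (Fin m) (Fin m) ℝ} (hT : Sigᵀ = Sig)
    (H X : Matrix (Fin 1) (Fin m) ℝ) :
    (X * Sig * Hᵀ) 0 0 + (H * (X * Sig)ᵀ) 0 0 + (H * Sig * Hᵀ) 0 0 + (X * Sig * Xᵀ) 0 0 =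
      ((X + H) * Sig * (X + H)ᵀ) 0 0 := by
  simp only [← Matrix.add_apply]
  refine congrArg (fun M : Matrix (Fin 1) (Fin 1) ℝ => M 0 0) ?_
  rw [transpose_mul, hT, transpose_add]
  simp only [Matrix.add_mul, Matrix.mul_add, Matrix.mul_assoc]
  abel

theorem quadratic_form_nonneg {m : ℕ} {Sig : Matrix (Fin m) (Fin m) ℝ} (hSig : Sig.PosDef)
    (X : Matrix (Fin 1) (Fin m) ℝ) : 0 ≤ (X * Sig * Xᵀ) 0 0 := by
  have h := (hSig.posSemidef.mul_mul_conjTranspose_same X).diag_nonneg (i := 0)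
  rwa [conjTranspose_eq_transpose_of_trivial] at h

theorem TSdp_subset_SCap {m : ℕ} (F : Matrix (Fin m) (Fin m) ℝ) (G : Matrix (Fin m) (Fin 1) ℝ)
    (H : Matrix (Fin 1) (Fin m) ℝ) (P : ℝ) : TSdp F G H P ⊆ SCap F G H P := by
  rintro Y ⟨K, Sig, hSig, hK, hR, hYeq⟩
  have hT : Sigᵀ = Sig := hSig.isHermitian
  have hdet : IsUnit Sig.det := (isUnit_iff_isUnit_det _).1 hSig.isUnit
  obtain ⟨X, rfl⟩ : ∃ X, K = X * Sig :=
    ⟨K * Sig⁻¹, (nonsing_inv_mul_cancel_right _ _ hdet).symm⟩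
  rw [posDef_power_block_iff hSig] at hK
  have hout := output_power_eq hT H X
  have hnn := quadratic_form_nonneg hSig (X + H)
  have hY : 0 < Y := by linarith
  rw [posSemidef_riccati_block_iff hY, cross_term_eq hT] at hR
  refine ⟨P - (X * Sig * Xᵀ) 0 0, X, Sig, _, by linarith, hSig, by linarith, ?_, rfl, by linarith⟩
  rwa [riccati_slack_eq hY.ne']

theorem exists_mem_TSdp_ge {m : ℕ} {F : Matrix (Fin m) (Fin m) ℝ} {G : Matrix (Fin m) (Fin 1) ℝ}
    {H : Matrix (Fin 1) (Fin m) ℝ} {P Y : ℝ} (hYS : Y ∈ SCap F G H P) :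
    ∃ Y' ∈ TSdp F G H P, Y ≤ Y' := by
  obtain ⟨V, X, Sig, Γ, hV, hSig, hpow, hR, rfl, hYeq⟩ := hYS
  have hT : Sigᵀ = Sig := hSig.isHermitian
  have hout := output_power_eq hT H X
  have hnn := quadratic_form_nonneg hSig (X + H)
  have hY : 0 < Y := by linarith
  set Y' := (X * Sig * Hᵀ) 0 0 + (H * (X * Sig)ᵀ) 0 0 + (H * Sig * Hᵀ) 0 0 + P + 1 with hY'
  have hle : Y ≤ Y' := by linarith
  refine ⟨Y', ⟨X * Sig, Sig, hSig, (posDef_power_block_iff hSig P X).2 (by linarith), ?_, hY'⟩, hle⟩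
  rw [posSemidef_riccati_block_iff (hY.trans_le hle), cross_term_eq hT]
  rw [riccati_slack_eq hY.ne'] at hR
  have hgap := (posSemidef_self_mul_conjTranspose (F * Sig * (X + H)ᵀ + G)).smul
    (sub_nonneg.2 (inv_anti₀ hY hle))
  rw [conjTranspose_eq_transpose_of_trivial, sub_smul] at hgap
  convert! hR.add hgap using 1
  abel

/-- The stationary feedback-capacity optimization problem is equivalent to the
semidefinite program: the two feasible sets have the same supremum, so the
feedback capacity equals `(1/2)·log₂(sup T)`. -/
theorem capacity_sdp_equivalence {m : ℕ}
    (F : Matrix (Fin m) (Fin m) ℝ) (G : Matrix (Fin m) (Fin 1) ℝ)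
    (H : Matrix (Fin 1) (Fin m) ℝ) (P : ℝ) (hP : 0 < P)
    (hneS : (SCap F G H P).Nonempty) (hneT : (TSdp F G H P).Nonempty)
    (hbddS : BddAbove (SCap F G H P)) (hbddT : BddAbove (TSdp F G H P)) :
    sSup (SCap F G H P) = sSup (TSdp F G H P) ∧
    (1 / 2) * Real.logb 2 (sSup (SCap F G H P))
      = (1 / 2) * Real.logb 2 (sSup (TSdp F G H P)) := by
  have hsup : sSup (SCap F G H P) = sSup (TSdp F G H P) := by
    apply le_antisymm
    · refine csSup_le hneS fun Y hY => ?_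
      obtain ⟨Y', hY', hle⟩ := exists_mem_TSdp_ge hY
      exact hle.trans (le_csSup hbddT hY')
    · exact csSup_le_csSup hbddS hneT (TSdp_subset_SCap F G H P)
  exact ⟨hsup, by rw [hsup]⟩
end
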